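/- Let d = d₁ + d₂ and let P ∈ P_d be a product measure P = P₁ ⊗ P₂ with P₁ ∈ P_{d₁} and P₂ ∈ P_{d₂}. Then for all x = (x₁ᵀ, x₂ᵀ)ᵀ with x₁ ∈ ℝ^{d₁}, x₂ ∈ ℝ^{d₂}, the log-concave projections satisfy ψ*(P)(x) = ψ*(P₁)(x₁) · ψ*(P₂)(x₂). -/

import Mathlib

open MeasureTheory Filter Set
open scoped ENNReal Topology

noncomputable section

/-- `ℝ^d` with its Euclidean norm and Lebesgue measure. -/
abbrev Rd (d : ℕ) : Type := EuclideanSpace ℝ (Fin d)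

/-- A nonnegative function is log-concave (`log f` is concave, with `log 0 := -∞`),
expressed multiplicatively via `f x ^ (1-t) * f y ^ t ≤ f ((1-t) • x + t • y)`. -/
def IsLogConcaveFn {E : Type*} [AddCommGroup E] [Module ℝ E] (f : E → ℝ) : Prop :=
  (∀ x, 0 ≤ f x) ∧
  ∀ x y : E, ∀ t : ℝ, t ∈ Set.Icc (0:ℝ) 1 →
    f x ^ (1 - t) * f y ^ t ≤ f ((1 - t) • x + t • y)

/-- A probability density with respect to the (Lebesgue) measure of a `MeasureSpace`. -/
def IsDensity {E : Type*} [MeasureSpace E] (f : E → ℝ) : Prop :=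
  (∀ x, 0 ≤ f x) ∧ Measurable f ∧ ∫⁻ x, ENNReal.ofReal (f x) = 1

/-- Membership in the class `F_d`: an upper semi-continuous log-concave probability
density. -/
def IsLCDensity {E : Type*} [MeasureSpace E] [TopologicalSpace E] [AddCommGroup E]
    [Module ℝ E] (f : E → ℝ) : Prop :=
  IsDensity f ∧ UpperSemicontinuous f ∧ IsLogConcaveFn f

/-- Membership in the class `P_d`: probability measures with finite first moment that are
not concentrated on any affine hyperplane `{x | l x = c}` (`l` a nonzero linear
functional). -/
def MemP {E : Type*} [NormedAddCommGroup E] [NormedSpace ℝ E] [MeasureSpace E]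
    (P : Measure E) : Prop :=
  IsProbabilityMeasure P ∧ Integrable (fun x => ‖x‖) P ∧
  ∀ (l : E →ₗ[ℝ] ℝ) (c : ℝ), l ≠ 0 → P {x | l x = c} < 1

/-- The log-concave projection predicate: `fs ∈ F_d` maximises `∫ log f dP` over `F_d`
(candidates whose objective is `-∞`, i.e. that vanish on a set of positive `P`-measure or
have non-integrable logarithm, are trivially dominated). -/
def IsLCProj {E : Type*} [NormedAddCommGroup E] [NormedSpace ℝ E] [MeasureSpace E]
    (P : Measure E) (fs : E → ℝ) : Prop :=
  IsLCDensity fs ∧ (∀ᵐ x ∂P, 0 < fs x) ∧ Integrable (fun x => Real.log (fs x)) P ∧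
  ∀ g : E → ℝ, IsLCDensity g → (∀ᵐ x ∂P, 0 < g x) →
    Integrable (fun x => Real.log (g x)) P →
    ∫ x, Real.log (g x) ∂P ≤ ∫ x, Real.log (fs x) ∂P

/-- `log y` with values in `[-∞, ∞)`, with the convention `log 0 := -∞`. -/
def elog (y : ℝ) : EReal := if y ≤ 0 then ⊥ else ((Real.log y : ℝ) : EReal)

/-- Positive part of an extended real number, as an `ℝ≥0∞`. -/
def epos (a : EReal) : ℝ≥0∞ := if a = ⊤ then ⊤ else ENNReal.ofReal a.toReal

/-- `e^a` for an extended real `a`, valued in `[0,∞]`. -/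
def expE (a : EReal) : ℝ≥0∞ :=
  if a = ⊥ then 0 else if a = ⊤ then ⊤ else ENNReal.ofReal (Real.exp a.toReal)

/-- Integral of an `EReal`-valued function: positive part minus negative part. -/
def erealIntegral {α : Type*} [MeasurableSpace α] (P : Measure α) (φ : α → EReal) : EReal :=
  ((∫⁻ x, epos (φ x) ∂P : ℝ≥0∞) : EReal) - ((∫⁻ x, epos (-(φ x)) ∂P : ℝ≥0∞) : EReal)

/-- The class `Φ`: upper semi-continuous, concave functions `φ : E → [-∞, ∞)` with
`φ(x) → -∞` as `‖x‖ → ∞`. -/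
def MemPhi {E : Type*} [NormedAddCommGroup E] [NormedSpace ℝ E] (φ : E → EReal) : Prop :=
  (∀ x, φ x ≠ ⊤) ∧ UpperSemicontinuous φ ∧
  (∀ x y : E, ∀ t : ℝ, t ∈ Set.Icc (0:ℝ) 1 →
    (((1 - t : ℝ)) : EReal) * φ x + ((t : ℝ) : EReal) * φ y ≤ φ ((1 - t) • x + t • y)) ∧
  Tendsto φ (Filter.comap (fun x => ‖x‖) Filter.atTop) (nhds ⊥)

/-- The functional `L(φ, P) = ∫ φ dP - ∫ e^φ dx`. -/
def Lfun {E : Type*} [NormedAddCommGroup E] [NormedSpace ℝ E] [MeasureSpace E]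
    (φ : E → EReal) (P : Measure E) : EReal :=
  erealIntegral P φ - ((∫⁻ x, expE (φ x) : ℝ≥0∞) : EReal)

/-- `L*(P) = sup_{φ ∈ Φ} L(φ, P)`. -/
def Lstar {E : Type*} [NormedAddCommGroup E] [NormedSpace ℝ E] [MeasureSpace E]
    (P : Measure E) : EReal :=
  ⨆ (φ : E → EReal) (_ : MemPhi φ), Lfun φ P

/-- Action of a matrix on a Euclidean vector. -/
def mulVE {m d : ℕ} (A : Matrix (Fin m) (Fin d) ℝ) (x : Rd d) : Rd m :=
  (WithLp.equiv 2 (Fin m → ℝ)).symm (A.mulVec ((WithLp.equiv 2 (Fin d → ℝ)) x))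

section LogConcave

variable {E : Type*} [NormedAddCommGroup E] [NormedSpace ℝ E]

theorem IsLogConcaveFn.convex_setOf_le {f : E → ℝ} (hf : IsLogConcaveFn f) {c : ℝ} (hc : 0 < c) :
    Convex ℝ {x | c ≤ f x} := by
  intro x hx y hy a b ha hb hab
  obtain rfl : a = 1 - b := by linarith
  refine le_trans ?_ (hf.2 x y b ⟨hb, by linarith⟩)
  calc c = c ^ (1 - b) * c ^ b := by rw [← Real.rpow_add hc]; simp
    _ ≤ f x ^ (1 - b) * f y ^ b := by
      have hx' : c ≤ f x := hx
      have hy' : c ≤ f y := hy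
      have := Real.rpow_nonneg (hf.1 x) (1 - b)
      gcongr

theorem IsLogConcaveFn.convex_setOf_pos {f : E → ℝ} (hf : IsLogConcaveFn f) :
    Convex ℝ {x | 0 < f x} := by
  intro x hx y hy a b ha hb hab
  obtain rfl : a = 1 - b := by linarith
  exact lt_of_lt_of_le (mul_pos (Real.rpow_pos_of_pos hx _) (Real.rpow_pos_of_pos hy _))
    (hf.2 x y b ⟨hb, by linarith⟩)

theorem IsLogConcaveFn.rpow_const {f : E → ℝ} (hf : IsLogConcaveFn f) {p : ℝ} (hp : 0 ≤ p) :
    IsLogConcaveFn fun x => f x ^ p := by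
  refine ⟨fun x => Real.rpow_nonneg (hf.1 x) _, fun x y t ht => ?_⟩
  rw [← Real.rpow_mul (hf.1 x), ← Real.rpow_mul (hf.1 y), mul_comm p, mul_comm p,
    Real.rpow_mul (hf.1 x), Real.rpow_mul (hf.1 y),
    ← Real.mul_rpow (Real.rpow_nonneg (hf.1 x) _) (Real.rpow_nonneg (hf.1 y) _)]
  exact Real.rpow_le_rpow (mul_nonneg (Real.rpow_nonneg (hf.1 x) _) (Real.rpow_nonneg (hf.1 y) _))
    (hf.2 x y t ht) hp

theorem IsLogConcaveFn.mul {f g : E → ℝ} (hf : IsLogConcaveFn f) (hg : IsLogConcaveFn g) :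
    IsLogConcaveFn fun x => f x * g x := by
  refine ⟨fun x => mul_nonneg (hf.1 x) (hg.1 x), fun x y t ht => ?_⟩
  rw [Real.mul_rpow (hf.1 x) (hg.1 x), Real.mul_rpow (hf.1 y) (hg.1 y), mul_mul_mul_comm]
  exact mul_le_mul (hf.2 x y t ht) (hg.2 x y t ht)
    (mul_nonneg (Real.rpow_nonneg (hg.1 x) _) (Real.rpow_nonneg (hg.1 y) _)) (hf.1 _)

theorem IsLogConcaveFn.div_const {f : E → ℝ} (hf : IsLogConcaveFn f) {c : ℝ} (hc : 0 < c) :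
    IsLogConcaveFn fun x => f x / c := by
  refine ⟨fun x => div_nonneg (hf.1 x) hc.le, fun x y t ht => ?_⟩
  have h : c ^ (1 - t) * c ^ t = c := by rw [← Real.rpow_add hc]; simp
  rw [Real.div_rpow (hf.1 x) hc.le, Real.div_rpow (hf.1 y) hc.le, div_mul_div_comm, h]
  exact div_le_div_of_nonneg_right (hf.2 x y t ht) hc.le

end LogConcave

section Semicontinuous

variable {E : Type*} [TopologicalSpace E]

theorem UpperSemicontinuous.mul_of_nonneg {f g : E → ℝ} (hf : UpperSemicontinuous f)
    (hg : UpperSemicontinuous g) (hf0 : ∀ x, 0 ≤ f x) (hg0 : ∀ x, 0 ≤ g x) :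
    UpperSemicontinuous fun x => f x * g x := by
  intro x y hy
  have hc : Tendsto (fun e : ℝ => (f x + e) * (g x + e)) (𝓝[>] 0) (𝓝 (f x * g x)) := by
    have : Continuous fun e : ℝ => (f x + e) * (g x + e) := by fun_prop
    simpa using (this.tendsto 0).mono_left nhdsWithin_le_nhds
  obtain ⟨e, he, he0⟩ := ((hc.eventually (gt_mem_nhds hy)).and self_mem_nhdsWithin).exists
  have he0 : 0 < e := he0
  filter_upwards [hf x (f x + e) (by linarith), hg x (g x + e) (by linarith)] with z hz1 hz2
  exact (mul_le_mul hz1.le hz2.le (hg0 z) (by linarith [hf0 x])).trans_lt he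

theorem UpperSemicontinuous.rpow_of_nonneg {f : E → ℝ} (hf : UpperSemicontinuous f)
    (hf0 : ∀ x, 0 ≤ f x) {p : ℝ} (hp : 0 ≤ p) : UpperSemicontinuous fun x => f x ^ p := by
  intro x y hy
  have hc : Tendsto (fun e : ℝ => (f x + e) ^ p) (𝓝[>] 0) (𝓝 (f x ^ p)) := by
    have : Continuous fun e : ℝ => (f x + e) ^ p :=
      (continuous_const.add continuous_id).rpow_const fun _ => Or.inr hp
    simpa using (this.tendsto 0).mono_left nhdsWithin_le_nhds
  obtain ⟨e, he, he0⟩ := ((hc.eventually (gt_mem_nhds hy)).and self_mem_nhdsWithin).exists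
  have he0 : 0 < e := he0
  filter_upwards [hf x (f x + e) (by linarith)] with z hz
  exact (Real.rpow_le_rpow (hf0 z) hz.le hp).trans_lt he

theorem UpperSemicontinuous.div_const_of_pos {f : E → ℝ} (hf : UpperSemicontinuous f) {c : ℝ}
    (hc : 0 < c) : UpperSemicontinuous fun x => f x / c := by
  intro x y hy
  filter_upwards [hf x (y * c) ((div_lt_iff₀ hc).1 hy)] with z hz
  exact (div_lt_iff₀ hc).2 hz

end Semicontinuous

section Density

theorem IsDensity.integrable {E : Type*} [MeasureSpace E] {f : E → ℝ} (hf : IsDensity f) : Integrable f :=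
  ⟨hf.2.1.aestronglyMeasurable, by
    rw [hasFiniteIntegral_iff_ofReal (ae_of_all _ hf.1), hf.2.2]; exact ENNReal.one_lt_top⟩

variable {E : Type*} [NormedAddCommGroup E] [NormedSpace ℝ E] [FiniteDimensional ℝ E]
  [MeasureSpace E] [BorelSpace E] [(volume : Measure E).IsAddHaarMeasure]

theorem IsLCDensity.exists_ball_le {f : E → ℝ} (hf : IsLCDensity f) :
    ∃ (z : E) (r c : ℝ), 0 < r ∧ 0 < c ∧ ∀ y ∈ Metric.ball z r, c ≤ f y := by
  obtain ⟨c, hc, hvol⟩ : ∃ c : ℝ, 0 < c ∧ volume {x | c ≤ f x} ≠ 0 := by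
    by_contra! h
    have h0 : volume {x | 0 < f x} = 0 := by
      refine measure_mono_null (t := ⋃ n : ℕ, {x | 1 / ((n : ℝ) + 1) ≤ f x}) (fun x hx => ?_)
        (measure_iUnion_null fun n => h _ (by positivity))
      obtain ⟨n, hn⟩ := exists_nat_one_div_lt (show (0 : ℝ) < f x from hx)
      exact mem_iUnion.2 ⟨n, hn.le⟩
    have h1 : ∫⁻ x, ENNReal.ofReal (f x) = 0 := by
      rw [lintegral_eq_zero_iff hf.1.2.1.ennreal_ofReal]
      filter_upwards [measure_eq_zero_iff_ae_notMem.1 h0] with x hx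
      simpa using hx
    rw [hf.1.2.2] at h1
    exact one_ne_zero h1
  have hconv := hf.2.2.convex_setOf_le hc
  have hne : (interior {x | c ≤ f x}).Nonempty := by
    rw [nonempty_iff_ne_empty]
    intro he
    refine hvol (measure_mono_null ?_ (hconv.addHaar_frontier volume))
    rw [frontier, he, sdiff_empty]
    exact subset_closure
  obtain ⟨z, hz⟩ := hne
  obtain ⟨r, hr, hball⟩ := Metric.mem_nhds_iff.1 (mem_interior_iff_mem_nhds.1 hz)
  exact ⟨z, r, c, hr, hc, fun y hy => hball hy⟩

theorem IsLCDensity.exists_bound {f : E → ℝ} (hf : IsLCDensity f) :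
    ∃ M : ℝ, 0 < M ∧ ∀ x, f x ≤ M := by
  obtain ⟨z, r, c, hr, hc, hball⟩ := hf.exists_ball_le
  set v : ℝ := volume.real (Metric.ball (0 : E) (r / 2)) with hv
  have hvpos : 0 < v := by
    refine ENNReal.toReal_pos (Metric.measure_ball_pos _ _ (by positivity)).ne' measure_ball_lt_top.ne
  refine ⟨1 / (v * c ^ (1 / 2 : ℝ)) ^ 2, by positivity, fun y => ?_⟩
  have hle : ∀ x ∈ Metric.ball ((1 / 2 : ℝ) • z + (1 / 2 : ℝ) • y) (r / 2),
      c ^ (1 / 2 : ℝ) * f y ^ (1 / 2 : ℝ) ≤ f x := by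
    intro x hx
    have h1 : (2 : ℝ) • x - y ∈ Metric.ball z r := by
      rw [mem_ball_iff_norm] at hx ⊢
      have : (2 : ℝ) • x - y - z = (2 : ℝ) • (x - ((1 / 2 : ℝ) • z + (1 / 2 : ℝ) • y)) := by
        module
      rw [this, norm_smul]
      norm_num
      norm_num at hx
      linarith
    have h2 := hf.2.2.2 ((2 : ℝ) • x - y) y (1 / 2) (by norm_num)
    have h3 : (1 - 1 / 2 : ℝ) • ((2 : ℝ) • x - y) + (1 / 2 : ℝ) • y = x := by module
    rw [h3] at h2
    norm_num at h2 ⊢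
    refine le_trans ?_ h2
    gcongr
    · exact Real.rpow_nonneg (hf.1.1 y) _
    · exact hball _ h1
  have hint : v * (c ^ (1 / 2 : ℝ) * f y ^ (1 / 2 : ℝ)) ≤ 1 := by
    have h1 : ∫ x, f x = 1 := by
      rw [integral_eq_lintegral_of_nonneg_ae (ae_of_all _ hf.1.1)
        hf.1.2.1.aestronglyMeasurable, hf.1.2.2]; simp
    refine le_trans ?_ ((setIntegral_le_integral
      (s := Metric.ball ((1 / 2 : ℝ) • z + (1 / 2 : ℝ) • y) (r / 2))
      hf.1.integrable (ae_of_all _ hf.1.1)).trans_eq h1)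
    have h2 := setIntegral_mono_on (μ := volume)
      (s := Metric.ball ((1 / 2 : ℝ) • z + (1 / 2 : ℝ) • y) (r / 2))
      (integrableOn_const measure_ball_lt_top.ne) hf.1.integrable.integrableOn
      measurableSet_ball hle
    rw [setIntegral_const, Measure.real, Measure.addHaar_ball_center] at h2
    exact h2
  have hy : f y = (f y ^ (1 / 2 : ℝ)) ^ 2 := by
    rw [← Real.sqrt_eq_rpow, Real.sq_sqrt (hf.1.1 y)]
  rw [hy, le_div_iff₀ (by positivity), ← mul_pow]
  refine pow_le_one₀ (mul_nonneg (Real.rpow_nonneg (hf.1.1 y) _) (by positivity)) ?_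
  linarith

theorem IsLCDensity.integrable_rpow_half {f : E → ℝ} (hf : IsLCDensity f) :
    Integrable fun x => f x ^ (1 / 2 : ℝ) := by
  obtain ⟨z, r, c, hr, hc, hball⟩ := hf.exists_ball_le
  have h1 : Integrable fun x => f ((1 / 2 : ℝ) • x + (1 / 2 : ℝ) • z) :=
    (hf.1.integrable.comp_add_right ((1 / 2 : ℝ) • z)).comp_smul (by norm_num : (1 / 2 : ℝ) ≠ 0)
  refine (h1.div_const (c ^ (1 / 2 : ℝ))).mono' (hf.1.2.1.pow_const _).aestronglyMeasurable
    (ae_of_all _ fun x => ?_)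
  rw [Real.norm_of_nonneg (Real.rpow_nonneg (hf.1.1 x) _), le_div_iff₀ (by positivity)]
  have h2 := hf.2.2.2 x z (1 / 2) (by norm_num)
  norm_num at h2 ⊢
  refine le_trans ?_ h2
  gcongr
  · exact Real.rpow_nonneg (hf.1.1 x) _
  · exact hball z (Metric.mem_ball_self hr)

theorem IsLCDensity.le_of_ae_eq {f g : E → ℝ} (hf : IsLCDensity f) (hg : UpperSemicontinuous g)
    (hg0 : ∀ x, 0 ≤ g x) (hfg : f =ᵐ[volume] g) (x : E) : f x ≤ g x := by
  rcases (hf.1.1 x).eq_or_lt with h0 | hpos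
  · rw [← h0]; exact hg0 x
  obtain ⟨z, r, c, hr, hc, hball⟩ := hf.exists_ball_le
  by_contra! hlt
  obtain ⟨b, hgb, hbf⟩ := exists_between hlt
  obtain ⟨ε, hε, hnear⟩ := Metric.eventually_nhds_iff.1 (hg x b hgb)
  have hlim : Tendsto (fun t : ℝ => f x ^ (1 - t) * c ^ t) (𝓝[>] 0) (𝓝 (f x)) := by
    have : Continuous fun t : ℝ => f x ^ (1 - t) * c ^ t :=
      ((Real.continuous_const_rpow hpos.ne').comp (continuous_const.sub continuous_id)).mul
        (Real.continuous_const_rpow hc.ne')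
    simpa using (this.tendsto 0).mono_left nhdsWithin_le_nhds
  have hsmall : Tendsto (fun t : ℝ => t * (r + dist z x)) (𝓝[>] 0) (𝓝 0) := by
    have : Continuous fun t : ℝ => t * (r + dist z x) := by fun_prop
    simpa using (this.tendsto 0).mono_left nhdsWithin_le_nhds
  have h1 : ∀ᶠ t : ℝ in 𝓝[>] 0, t < 1 := nhdsWithin_le_nhds (gt_mem_nhds one_pos)
  obtain ⟨t, ⟨⟨ht1, ht2⟩, ht3⟩, ht0⟩ := (((hlim.eventually (lt_mem_nhds hbf)).and
    (hsmall.eventually (gt_mem_nhds hε))).and h1).and self_mem_nhdsWithin |>.exists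
  have ht0 : 0 < t := ht0
  have hnull : ∃ w ∈ Metric.ball ((1 - t) • x + t • z) (t * r), f w = g w := by
    by_contra! h
    have hz : volume (Metric.ball ((1 - t) • x + t • z) (t * r)) = 0 :=
      measure_mono_null (fun w hw => h w hw) hfg
    exact (Metric.measure_ball_pos volume _ (by positivity)).ne' hz
  obtain ⟨w, hw, hwe⟩ := hnull
  rw [mem_ball_iff_norm] at hw
  obtain ⟨y, rfl⟩ : ∃ y, w = (1 - t) • x + t • y :=
    ⟨t⁻¹ • (w - (1 - t) • x), by rw [smul_inv_smul₀ ht0.ne']; abel⟩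
  have hy : ‖y - z‖ < r := by
    have : (1 - t) • x + t • y - ((1 - t) • x + t • z) = t • (y - z) := by module
    rw [this, norm_smul, Real.norm_of_nonneg ht0.le] at hw
    exact lt_of_mul_lt_mul_left hw ht0.le
  have hdist : dist ((1 - t) • x + t • y) x < ε := by
    have : (1 - t) • x + t • y - x = t • ((y - z) + (z - x)) := by module
    rw [dist_eq_norm, this, norm_smul, Real.norm_of_nonneg ht0.le]
    refine lt_of_le_of_lt ?_ ht2
    gcongr
    refine (norm_add_le _ _).trans ?_
    rw [dist_eq_norm]
    linarith
  have h2 := hnear hdist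
  have h3 := hf.2.2.2 x y t ⟨ht0.le, ht3.le⟩
  have h4 : f x ^ (1 - t) * c ^ t ≤ f x ^ (1 - t) * f y ^ t := by
    gcongr
    exact hball y (mem_ball_iff_norm.2 hy)
  rw [hwe] at h3
  linarith

end Density

section FirstOrder

theorem le_integral_log_of_forall_rpow {α : Type*} [MeasurableSpace α] {ν : Measure α}
    [IsProbabilityMeasure ν] {u : α → ℝ} (hu : Measurable u) (hu0 : ∀ x, 0 ≤ u x) {b : ℝ}
    (h : ∀ t ∈ Ioc (0 : ℝ) (1 / 2),
      Integrable (fun x => u x ^ t) ν ∧ t * b ≤ ∫ x, u x ^ t ∂ν - 1) :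
    (∀ᵐ x ∂ν, 0 < u x) ∧ Integrable (fun x => Real.log (u x)) ν ∧
      b ≤ ∫ x, Real.log (u x) ∂ν := by
  let D : ℝ → α → ℝ := fun t x => t⁻¹ * (1 - u x ^ t)
  have hDm : ∀ t, Measurable (D t) := fun t => ((hu.pow_const t).const_sub 1).const_mul _
  have hDi : ∀ t ∈ Ioc (0 : ℝ) (1 / 2), Integrable (D t) ν := fun t ht =>
    ((integrable_const 1).sub (h t ht).1).const_mul _
  have hDint : ∀ t ∈ Ioc (0 : ℝ) (1 / 2), ∫ x, D t x ∂ν ≤ -b := by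
    intro t ht
    have : ∫ x, D t x ∂ν = t⁻¹ * (1 - ∫ x, u x ^ t ∂ν) := by
      simp only [D]
      rw [integral_const_mul, integral_sub (integrable_const 1) (h t ht).1]
      simp
    rw [this, inv_mul_le_iff₀ ht.1]
    linarith [(h t ht).2]
  have hmono : ∀ t ∈ Ioc (0 : ℝ) (1 / 2), ∀ x, D (1 / 2) x ≤ D t x := by
    intro t ht x
    have h1 := rpow_one_add_le_one_add_mul_self (s := u x ^ (1 / 2 : ℝ) - 1) (p := 2 * t)
      (by linarith [Real.rpow_nonneg (hu0 x) (1 / 2)]) (by linarith [ht.1]) (by linarith [ht.2])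
    rw [add_sub_cancel, ← Real.rpow_mul (hu0 x)] at h1
    have h2 : (1 / 2 : ℝ) * (2 * t) = t := by ring
    rw [h2] at h1
    simp only [D]
    rw [le_inv_mul_iff₀ ht.1]
    norm_num at h1 ⊢
    linarith
  let s : ℕ → ℝ := fun n => 1 / ((n : ℝ) + 2)
  have hs : ∀ n, s n ∈ Ioc (0 : ℝ) (1 / 2) := fun n =>
    ⟨by positivity, one_div_le_one_div_of_le (by norm_num) (by linarith [n.cast_nonneg (α := ℝ)])⟩
  have hs_inv : Tendsto (fun n => (s n)⁻¹) atTop atTop := by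
    simp only [s, one_div, inv_inv]
    exact tendsto_atTop_add_const_right _ _ tendsto_natCast_atTop_atTop
  have hs_lim : Tendsto s atTop (𝓝[≠] 0) := by
    refine tendsto_nhdsWithin_iff.2 ⟨?_, Eventually.of_forall fun n => (hs n).1.ne'⟩
    exact hs_inv.inv_tendsto_atTop.congr fun n => inv_inv (s n)
  have hlim0 : ∀ x, u x = 0 →
      Tendsto (fun n => ENNReal.ofReal (D (s n) x - D (1 / 2) x)) atTop (𝓝 ⊤) := by
    intro x hx
    refine ENNReal.tendsto_ofReal_atTop.comp ?_
    have : ∀ n, D (s n) x - D (1 / 2) x = (s n)⁻¹ + -D (1 / 2) x := by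
      intro n
      simp only [D]
      rw [hx, Real.zero_rpow (hs n).1.ne']; ring
    simp only [this]
    exact tendsto_atTop_add_const_right _ _ hs_inv
  have hlim1 : ∀ x, 0 < u x →
      Tendsto (fun n => ENNReal.ofReal (D (s n) x - D (1 / 2) x)) atTop
        (𝓝 (ENNReal.ofReal (-Real.log (u x) - D (1 / 2) x))) := by
    intro x hx
    refine ENNReal.tendsto_ofReal (Tendsto.sub_const ?_ _)
    have h1 : HasDerivAt (fun t : ℝ => u x ^ t) (Real.log (u x)) 0 := by
      simpa using (Real.hasStrictDerivAt_const_rpow hx 0).hasDerivAt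
    have h2 := (hasDerivAt_iff_tendsto_slope_zero.1 h1).comp hs_lim
    refine h2.neg.congr fun n => ?_
    simp only [D, Function.comp, zero_add, Real.rpow_zero, smul_eq_mul]
    ring
  let R : ℝ := -b - ∫ x, D (1 / 2) x ∂ν
  have hR : 0 ≤ R := by have := hDint (1 / 2) (by norm_num); simp only [R]; linarith
  have hfatou : ∫⁻ x, liminf (fun n => ENNReal.ofReal (D (s n) x - D (1 / 2) x)) atTop ∂ν
      ≤ ENNReal.ofReal R := by
    refine (lintegral_liminf_le fun n => ((hDm _).sub (hDm _)).ennreal_ofReal).trans ?_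
    refine liminf_le_of_frequently_le' (Frequently.of_forall fun n => ?_)
    have hi := hDi (1 / 2) (by norm_num)
    rw [← ofReal_integral_eq_lintegral_ofReal ((hDi _ (hs n)).sub hi)
      (ae_of_all _ fun x => sub_nonneg.2 (hmono _ (hs n) x)), integral_sub' (hDi _ (hs n)) hi]
    exact ENNReal.ofReal_le_ofReal (sub_le_sub_right (hDint _ (hs n)) _)
  have hpos : ∀ᵐ x ∂ν, 0 < u x := by
    filter_upwards [ae_lt_top (Measurable.liminf fun n => ((hDm (s n)).sub (hDm _)).ennreal_ofReal)
      (hfatou.trans_lt ENNReal.ofReal_lt_top).ne] with x hx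
    refine (hu0 x).lt_of_ne fun h0 => ?_
    exact hx.ne (hlim0 x h0.symm).liminf_eq
  have hle : ∫⁻ x, ENNReal.ofReal (-Real.log (u x) - D (1 / 2) x) ∂ν ≤ ENNReal.ofReal R := by
    refine le_trans (le_of_eq (lintegral_congr_ae ?_)) hfatou
    filter_upwards [hpos] with x hx
    exact (hlim1 x hx).liminf_eq.symm
  have hnn : 0 ≤ᵐ[ν] fun x => -Real.log (u x) - D (1 / 2) x := by
    filter_upwards [hpos] with x hx
    have h1 := Real.log_le_sub_one_of_pos (Real.rpow_pos_of_pos hx (1 / 2))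
    rw [Real.log_rpow hx] at h1
    simp only [D, Pi.zero_apply]
    norm_num at h1 ⊢
    linarith
  have hm : Measurable fun x => -Real.log (u x) - D (1 / 2) x :=
    (Real.measurable_log.comp hu).neg.sub (hDm _)
  have hi : Integrable (fun x => -Real.log (u x) - D (1 / 2) x) ν :=
    ⟨hm.aestronglyMeasurable, by
      rw [hasFiniteIntegral_iff_ofReal hnn]; exact hle.trans_lt ENNReal.ofReal_lt_top⟩
  have hlog : Integrable (fun x => Real.log (u x)) ν := by
    refine (hi.add (hDi (1 / 2) (by norm_num))).neg.congr (ae_of_all _ fun x => ?_)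
    simp
  refine ⟨hpos, hlog, ?_⟩
  have hsplit : ∫ x, (-Real.log (u x) - D (1 / 2) x) ∂ν
      = -∫ x, Real.log (u x) ∂ν - ∫ x, D (1 / 2) x ∂ν := by
    rw [← integral_neg]
    exact integral_sub hlog.neg (hDi _ (by norm_num))
  rw [← ofReal_integral_eq_lintegral_ofReal hi hnn, ENNReal.ofReal_le_ofReal_iff hR, hsplit] at hle
  simp only [R] at hle
  linarith

variable {E : Type*} [NormedAddCommGroup E] [NormedSpace ℝ E] [FiniteDimensional ℝ E]
  [MeasureSpace E]

theorem MemP.interior_nonempty {P : Measure E} (hP : MemP P) {K : Set E} (hK : Convex ℝ K)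
    (hPK : ∀ᵐ x ∂P, x ∈ K) : (interior K).Nonempty := by
  have := hP.1
  obtain ⟨x₀, hx₀⟩ := hPK.exists
  rw [hK.interior_nonempty_iff_affineSpan_eq_top]
  by_contra hne
  have hdir : (affineSpan ℝ K).direction < ⊤ := by
    rw [lt_top_iff_ne_top, Ne, AffineSubspace.direction_eq_top_iff_of_nonempty]
    · exact hne
    · exact ⟨x₀, subset_affineSpan ℝ K hx₀⟩
  obtain ⟨l, hl, hker⟩ := Submodule.exists_le_ker_of_lt_top _ hdir
  refine (hP.2.2 l (l x₀) hl).not_ge ?_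
  have hsub : K ⊆ {x | l x = l x₀} := by
    intro x hx
    have h := hker (AffineSubspace.vsub_mem_direction (subset_affineSpan ℝ K hx)
      (subset_affineSpan ℝ K hx₀))
    rw [LinearMap.mem_ker, vsub_eq_sub, map_sub, sub_eq_zero] at h
    exact h
  rw [← measure_univ (μ := P)]
  exact measure_mono_ae (hPK.mono fun x hx _ => hsub hx)

variable [BorelSpace E] [(volume : Measure E).IsAddHaarMeasure]

/-- The measure with Lebesgue density `f`. -/
def densityMeasure {E : Type*} [MeasureSpace E] (f : E → ℝ) : Measure E :=
  volume.withDensity fun x => ENNReal.ofReal (f x)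

theorem IsDensity.isProbabilityMeasure {E : Type*} [MeasureSpace E] {f : E → ℝ}
    (hf : IsDensity f) : IsProbabilityMeasure (densityMeasure f) :=
  ⟨by rw [densityMeasure, withDensity_apply _ MeasurableSet.univ, setLIntegral_univ, hf.2.2]⟩

theorem IsDensity.ae_pos {E : Type*} [MeasureSpace E] {f : E → ℝ} (hf : IsDensity f) :
    ∀ᵐ x ∂densityMeasure f, 0 < f x := by
  rw [densityMeasure, ae_withDensity_iff hf.2.1.ennreal_ofReal]
  exact ae_of_all _ fun x hx => by simpa using hx

theorem IsDensity.integrable_densityMeasure_iff {E : Type*} [MeasureSpace E] {f : E → ℝ}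
    (hf : IsDensity f) {g : E → ℝ} :
    Integrable g (densityMeasure f) ↔ Integrable fun x => f x * g x := by
  rw [densityMeasure, integrable_withDensity_iff_integrable_smul' hf.2.1.ennreal_ofReal
    (ae_of_all _ fun _ => ENNReal.ofReal_lt_top)]
  simp only [ENNReal.toReal_ofReal (hf.1 _), smul_eq_mul]

theorem IsDensity.integral_densityMeasure {E : Type*} [MeasureSpace E] {f : E → ℝ}
    (hf : IsDensity f) (g : E → ℝ) :
    ∫ x, g x ∂densityMeasure f = ∫ x, f x * g x := by
  rw [densityMeasure, integral_withDensity_eq_integral_toReal_smul hf.2.1.ennreal_ofReal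
    (ae_of_all _ fun _ => ENNReal.ofReal_lt_top)]
  simp only [ENNReal.toReal_ofReal (hf.1 _), smul_eq_mul]

/-- Comparing a maximiser `f` with the normalised geometric interpolation `f ^ (1 - t) * g ^ t`. -/
theorem IsLCProj.mul_integral_log_sub_le {P : Measure E} (hP : MemP P) {f g : E → ℝ}
    (hf : IsLCProj P f) (hg : IsLogConcaveFn g) (hgu : UpperSemicontinuous g) {M : ℝ}
    (hM : ∀ x, g x ≤ M) (hgpos : ∀ᵐ x ∂P, 0 < g x)
    (hgi : Integrable (fun x => Real.log (g x)) P) {t : ℝ} (ht : t ∈ Ioc (0 : ℝ) (1 / 2)) :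
    Integrable (fun x => f x ^ (1 - t) * g x ^ t) ∧
      t * ∫ x, (Real.log (g x) - Real.log (f x)) ∂P ≤ (∫ x, f x ^ (1 - t) * g x ^ t) - 1 := by
  have := hP.1
  obtain ⟨hfd, hfpos, hfi, hmax⟩ := hf
  have ht1 : 0 ≤ 1 - t := by linarith [ht.2]
  set h : E → ℝ := fun x => f x ^ (1 - t) * g x ^ t with hh
  have hlc : IsLogConcaveFn h := (hfd.2.2.rpow_const ht1).mul (hg.rpow_const ht.1.le)
  have husc : UpperSemicontinuous h :=
    (hfd.2.1.rpow_of_nonneg hfd.1.1 ht1).mul_of_nonneg (hgu.rpow_of_nonneg hg.1 ht.1.le)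
      (fun x => Real.rpow_nonneg (hfd.1.1 x) _) fun x => Real.rpow_nonneg (hg.1 x) _
  have hint : Integrable h := by
    obtain ⟨M', hM'0, hM'⟩ := hfd.exists_bound
    refine (hfd.integrable_rpow_half.mul_const (M' ^ (1 / 2 - t) * M ^ t)).mono'
      husc.measurable.aestronglyMeasurable (ae_of_all _ fun x => ?_)
    have hsplit : f x ^ (1 - t) = f x ^ (1 / 2 : ℝ) * f x ^ (1 / 2 - t) := by
      rw [← Real.rpow_add_of_nonneg (hfd.1.1 x) (by norm_num) (by linarith [ht.2])]
      congr 1; ring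
    rw [Real.norm_of_nonneg (hlc.1 x), hh]
    simp only
    rw [hsplit, mul_assoc]
    have h1 : f x ^ (1 / 2 - t) ≤ M' ^ (1 / 2 - t) :=
      Real.rpow_le_rpow (hfd.1.1 x) (hM' x) (by linarith [ht.2])
    have h2 : g x ^ t ≤ M ^ t := Real.rpow_le_rpow (hg.1 x) (hM x) ht.1.le
    exact mul_le_mul_of_nonneg_left (mul_le_mul h1 h2 (Real.rpow_nonneg (hg.1 x) _)
      (Real.rpow_nonneg hM'0.le _)) (Real.rpow_nonneg (hfd.1.1 x) _)
  refine ⟨hint, ?_⟩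
  set Z : ℝ := ∫ x, h x with hZ
  have hZpos : 0 < Z := by
    rw [hZ, integral_pos_iff_support_of_nonneg hlc.1 hint]
    have hne := hP.interior_nonempty (hfd.2.2.convex_setOf_pos.inter hg.convex_setOf_pos)
      (hfpos.and hgpos)
    refine (isOpen_interior.measure_pos volume hne).trans_le (measure_mono ?_)
    refine interior_subset.trans fun x hx => ?_
    exact (mul_pos (Real.rpow_pos_of_pos hx.1 _) (Real.rpow_pos_of_pos hx.2 _)).ne'
  have hZd : IsLCDensity fun x => h x / Z := by
    refine ⟨⟨fun x => div_nonneg (hlc.1 x) hZpos.le, husc.measurable.div_const Z, ?_⟩,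
      husc.div_const_of_pos hZpos, hlc.div_const hZpos⟩
    rw [← ofReal_integral_eq_lintegral_ofReal (hint.div_const Z)
      (ae_of_all _ fun x => div_nonneg (hlc.1 x) hZpos.le), integral_div, div_self hZpos.ne',
      ENNReal.ofReal_one]
  have hlog : (fun x => Real.log (f x) + t * (Real.log (g x) - Real.log (f x)) - Real.log Z)
      =ᵐ[P] fun x => Real.log (h x / Z) := by
    filter_upwards [hfpos, hgpos] with x hfx hgx
    rw [Real.log_div (mul_pos (Real.rpow_pos_of_pos hfx _) (Real.rpow_pos_of_pos hgx _)).ne'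
      hZpos.ne', Real.log_mul (Real.rpow_pos_of_pos hfx _).ne' (Real.rpow_pos_of_pos hgx _).ne',
      Real.log_rpow hfx, Real.log_rpow hgx]
    ring
  have hi1 : Integrable (fun x => t * (Real.log (g x) - Real.log (f x))) P :=
    (hgi.sub hfi).const_mul t
  have hi2 : Integrable (fun x => Real.log (f x) + t * (Real.log (g x) - Real.log (f x))) P :=
    hfi.add hi1
  have key := hmax _ hZd
    (by
      filter_upwards [hfpos, hgpos] with x hfx hgx
      exact div_pos (mul_pos (Real.rpow_pos_of_pos hfx _) (Real.rpow_pos_of_pos hgx _)) hZpos)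
    ((hi2.sub (integrable_const (Real.log Z))).congr hlog)
  rw [← integral_congr_ae hlog, integral_sub hi2 (integrable_const _), integral_add hfi hi1,
    integral_const_mul] at key
  simp only [integral_const, probReal_univ, one_smul] at key
  linarith [Real.log_le_sub_one_of_pos hZpos]

/-- First-order optimality condition of the log-concave projection. -/
theorem IsLCProj.integral_log_sub_le {P : Measure E} (hP : MemP P) {f g : E → ℝ}
    (hf : IsLCProj P f) (hg : IsLogConcaveFn g) (hgu : UpperSemicontinuous g) {M : ℝ}
    (hM : ∀ x, g x ≤ M) (hgpos : ∀ᵐ x ∂P, 0 < g x)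
    (hgi : Integrable (fun x => Real.log (g x)) P) :
    (∀ᵐ x ∂densityMeasure f, 0 < g x) ∧
      Integrable (fun x => Real.log (g x) - Real.log (f x)) (densityMeasure f) ∧
      ∫ x, (Real.log (g x) - Real.log (f x)) ∂P
        ≤ ∫ x, (Real.log (g x) - Real.log (f x)) ∂densityMeasure f := by
  have hfd := hf.1
  have := hfd.1.isProbabilityMeasure
  have heq : ∀ t ∈ Ioc (0 : ℝ) (1 / 2), ∀ x, f x * (g x / f x) ^ t = f x ^ (1 - t) * g x ^ t := by
    intro t ht x
    rcases (hfd.1.1 x).eq_or_lt with h0 | h0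
    · rw [← h0, Real.zero_rpow (by linarith [ht.2]), zero_mul, zero_mul]
    · rw [Real.div_rpow (hg.1 x) h0.le, Real.rpow_sub h0, Real.rpow_one]
      ring
  obtain ⟨h1, h2, h3⟩ := le_integral_log_of_forall_rpow (ν := densityMeasure f)
    (u := fun x => g x / f x) (b := ∫ x, (Real.log (g x) - Real.log (f x)) ∂P)
    (hgu.measurable.div hfd.1.2.1) (fun x => div_nonneg (hg.1 x) (hfd.1.1 x)) (by
      intro t ht
      rw [hfd.1.integrable_densityMeasure_iff, hfd.1.integral_densityMeasure]
      simp only [heq t ht]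
      exact hf.mul_integral_log_sub_le hP hg hgu hM hgpos hgi ht)
  have hpos : ∀ᵐ x ∂densityMeasure f, 0 < g x := by
    filter_upwards [h1, hfd.1.ae_pos] with x hx hfx
    exact (div_pos_iff_of_pos_right hfx).1 hx
  have hlog : (fun x => Real.log (g x / f x)) =ᵐ[densityMeasure f]
      fun x => Real.log (g x) - Real.log (f x) := by
    filter_upwards [hpos, hfd.1.ae_pos] with x hx hfx
    exact Real.log_div hx.ne' hfx.ne'
  exact ⟨hpos, h2.congr hlog, h3.trans_eq (integral_congr_ae hlog)⟩

theorem IsLCProj.integrable_log {P : Measure E} (hP : MemP P) {f : E → ℝ} (hf : IsLCProj P f) :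
    Integrable (fun x => Real.log (f x)) (densityMeasure f) := by
  obtain ⟨M, hM0, hM⟩ := hf.1.exists_bound
  have h0 := hf.1.1.1
  have hlog : (fun x => 2 * Real.log (f x)) = fun x => Real.log (f x * f x) := by
    ext x
    rw [← sq, Real.log_pow]; norm_num
  obtain ⟨-, h, -⟩ := hf.integral_log_sub_le hP (hf.1.2.2.mul hf.1.2.2)
    (hf.1.2.1.mul_of_nonneg hf.1.2.1 h0 h0)
    (fun x => mul_le_mul (hM x) (hM x) (h0 x) hM0.le)
    (by filter_upwards [hf.2.1] with x hx using mul_pos hx hx)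
    (by rw [← hlog]; exact hf.2.2.1.const_mul 2)
  refine h.congr (ae_of_all _ fun x => ?_)
  have := congrFun hlog x
  simp only at this ⊢
  rw [← this]; ring

end FirstOrder

section PartialMean

/-- `-log y` as an extended nonnegative real, with `-log 0 = ∞`. -/
def negLog (y : ℝ) : ℝ≥0∞ := if y ≤ 0 then ⊤ else ENNReal.ofReal (-Real.log y)

/-- `exp (-a)` for an extended nonnegative real `a`. -/
def expNeg (a : ℝ≥0∞) : ℝ := if a = ⊤ then 0 else Real.exp (-a.toReal)

theorem negLog_of_pos {y : ℝ} (hy : 0 < y) : negLog y = ENNReal.ofReal (-Real.log y) :=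
  if_neg hy.not_ge

theorem negLog_lt_top_iff {y : ℝ} : negLog y < ⊤ ↔ 0 < y := by
  unfold negLog
  split_ifs with h
  · simpa using h
  · simpa using h

theorem measurable_negLog : Measurable negLog :=
  Measurable.ite measurableSet_Iic measurable_const Real.measurable_log.neg.ennreal_ofReal

theorem expNeg_nonneg (a : ℝ≥0∞) : 0 ≤ expNeg a := by
  unfold expNeg
  split_ifs
  · exact le_rfl
  · exact (Real.exp_pos _).le

theorem expNeg_le_one (a : ℝ≥0∞) : expNeg a ≤ 1 := by
  unfold expNeg
  split_ifs
  · exact zero_le_one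
  · simp

theorem expNeg_of_ne_top {a : ℝ≥0∞} (ha : a ≠ ⊤) : expNeg a = Real.exp (-a.toReal) := if_neg ha

theorem negLog_expNeg (a : ℝ≥0∞) : negLog (expNeg a) = a := by
  by_cases ha : a = ⊤
  · simp [ha, expNeg, negLog]
  · rw [expNeg_of_ne_top ha, negLog_of_pos (Real.exp_pos _), Real.log_exp, neg_neg,
      ENNReal.ofReal_toReal ha]

theorem negLog_le_iff {y : ℝ} {a : ℝ≥0∞} (ha : a ≠ ⊤) : negLog y ≤ a ↔ expNeg a ≤ y := by
  rw [expNeg_of_ne_top ha]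
  rcases le_or_gt y 0 with hy | hy
  · rw [negLog, if_pos hy, top_le_iff]
    exact iff_of_false ha (hy.trans_lt (Real.exp_pos _)).not_ge
  · rw [negLog_of_pos hy, ENNReal.ofReal_le_iff_le_toReal ha, ← Real.le_log_iff_exp_le hy, neg_le]

theorem le_expNeg_iff {y : ℝ} {a : ℝ≥0∞} (hy : 0 < y) (hy1 : y ≤ 1) :
    y ≤ expNeg a ↔ a ≤ negLog y := by
  by_cases ha : a = ⊤
  · simp [ha, expNeg, negLog, hy]
  · rw [expNeg_of_ne_top ha, negLog_of_pos hy, ENNReal.le_ofReal_iff_toReal_le ha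
      (neg_nonneg.2 (Real.log_nonpos hy.le hy1)), ← Real.log_le_iff_le_exp hy, le_neg]

theorem UpperSemicontinuous.negLog {E : Type*} [TopologicalSpace E] {k : E → ℝ}
    (hk : UpperSemicontinuous k) : LowerSemicontinuous fun x => negLog (k x) := by
  rw [lowerSemicontinuous_iff_isClosed_preimage]
  intro a
  by_cases ha : a = ⊤
  · simp [ha]
  · have : (fun x => _root_.negLog (k x)) ⁻¹' Iic a = k ⁻¹' Ici (expNeg a) := by
      ext x
      exact negLog_le_iff ha
    rw [this]
    exact upperSemicontinuous_iff_isClosed_preimage.1 hk _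

theorem lowerSemicontinuous_lintegral {α E : Type*} [MeasurableSpace α] [TopologicalSpace E]
    [SequentialSpace E] {ν : Measure α} {F : E → α → ℝ≥0∞} (hm : ∀ x, Measurable (F x))
    (hF : ∀ z, LowerSemicontinuous fun x => F x z) :
    LowerSemicontinuous fun x => ∫⁻ z, F x z ∂ν := by
  rw [lowerSemicontinuous_iff_isClosed_preimage]
  intro a
  refine IsSeqClosed.isClosed fun u x hu hux => ?_
  calc ∫⁻ z, F x z ∂ν ≤ ∫⁻ z, liminf (fun n => F (u n) z) atTop ∂ν := by
        refine lintegral_mono fun z => le_of_forall_lt fun b hb => ?_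
        obtain ⟨c, hbc, hc⟩ := exists_between hb
        exact hbc.trans_le (le_liminf_of_le (by isBoundedDefault)
          ((hux.eventually (hF z x c hc)).mono fun n hn => hn.le))
    _ ≤ liminf (fun n => ∫⁻ z, F (u n) z ∂ν) atTop := lintegral_liminf_le fun n => hm _
    _ ≤ a := liminf_le_of_frequently_le' (Frequently.of_forall hu)

theorem UpperSemicontinuous.expNeg {E : Type*} [TopologicalSpace E] {I : E → ℝ≥0∞}
    (hI : LowerSemicontinuous I) : UpperSemicontinuous fun x => expNeg (I x) := by
  rw [upperSemicontinuous_iff_isClosed_preimage]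
  intro y
  rcases le_or_gt y 0 with hy | hy
  · convert isClosed_univ
    exact eq_univ_of_forall fun x => hy.trans (expNeg_nonneg _)
  rcases le_or_gt y 1 with hy1 | hy1
  · have : (fun x => _root_.expNeg (I x)) ⁻¹' Ici y = I ⁻¹' Iic (_root_.negLog y) := by
      ext x
      exact le_expNeg_iff hy hy1
    rw [this]
    exact lowerSemicontinuous_iff_isClosed_preimage.1 hI _
  · convert isClosed_empty
    exact eq_empty_of_forall_notMem fun x hx => (hy1.trans_le hx).not_ge (expNeg_le_one _)

theorem integral_log_eq_of_negLog {α : Type*} [MeasurableSpace α] {ν : Measure α} {u : α → ℝ}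
    (hu : Measurable u) (hu1 : ∀ x, u x ≤ 1) (hI : ∫⁻ x, negLog (u x) ∂ν ≠ ⊤) :
    (∀ᵐ x ∂ν, 0 < u x) ∧ Integrable (fun x => Real.log (u x)) ν ∧
      ∫ x, Real.log (u x) ∂ν = -(∫⁻ x, negLog (u x) ∂ν).toReal := by
  have hpos : ∀ᵐ x ∂ν, 0 < u x :=
    (ae_lt_top (measurable_negLog.comp hu) hI).mono fun x hx => negLog_lt_top_iff.1 hx
  have heq : ∫⁻ x, negLog (u x) ∂ν = ∫⁻ x, ENNReal.ofReal (-Real.log (u x)) ∂ν :=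
    lintegral_congr_ae (hpos.mono fun x hx => negLog_of_pos hx)
  have hnn : 0 ≤ᵐ[ν] fun x => -Real.log (u x) :=
    hpos.mono fun x hx => neg_nonneg.2 (Real.log_nonpos hx.le (hu1 x))
  have hm : Measurable fun x => -Real.log (u x) := (Real.measurable_log.comp hu).neg
  have hi : Integrable (fun x => -Real.log (u x)) ν :=
    ⟨hm.aestronglyMeasurable, by
      rw [hasFiniteIntegral_iff_ofReal hnn, ← heq]; exact hI.lt_top⟩
  refine ⟨hpos, by simpa using hi.neg, ?_⟩
  rw [heq, ← integral_eq_lintegral_of_nonneg_ae hnn hm.aestronglyMeasurable, integral_neg, neg_neg]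

theorem lintegral_negLog_of_integrable {α : Type*} [MeasurableSpace α] {ν : Measure α} {u : α → ℝ}
    (hu1 : ∀ x, u x ≤ 1) (hpos : ∀ᵐ x ∂ν, 0 < u x)
    (hi : Integrable (fun x => Real.log (u x)) ν) :
    ∫⁻ x, negLog (u x) ∂ν = ENNReal.ofReal (-∫ x, Real.log (u x) ∂ν) := by
  rw [← integral_neg]
  refine (lintegral_congr_ae (hpos.mono fun x hx => negLog_of_pos hx)).trans
    (ofReal_integral_eq_lintegral_ofReal hi.neg ?_).symm
  exact hpos.mono fun x hx => neg_nonneg.2 (Real.log_nonpos hx.le (hu1 x))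

variable {E₁ E₂ : Type*} [NormedAddCommGroup E₁] [NormedSpace ℝ E₁] [NormedAddCommGroup E₂]
  [NormedSpace ℝ E₂]

theorem IsLogConcaveFn.negLog_le {k : E₁ → ℝ} (hk : IsLogConcaveFn k) (hk1 : ∀ x, k x ≤ 1)
    {x y : E₁} {t : ℝ} (ht : t ∈ Ioo (0 : ℝ) 1) :
    negLog (k ((1 - t) • x + t • y))
      ≤ ENNReal.ofReal (1 - t) * negLog (k x) + ENNReal.ofReal t * negLog (k y) := by
  have ht' : 0 < 1 - t := by linarith [ht.2]
  rcases (hk.1 x).eq_or_lt with hx | hx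
  · rw [← hx, negLog, negLog, if_pos le_rfl, ENNReal.mul_top (by simpa using ht.2)]; simp
  rcases (hk.1 y).eq_or_lt with hy | hy
  · rw [← hy, negLog, negLog, negLog, if_pos (le_refl (0 : ℝ)),
      ENNReal.mul_top (by simpa using ht.1)]; simp
  have h1 := hk.2 x y t ⟨ht.1.le, ht.2.le⟩
  have h2 : 0 < k x ^ (1 - t) * k y ^ t :=
    mul_pos (Real.rpow_pos_of_pos hx _) (Real.rpow_pos_of_pos hy _)
  have h3 := Real.log_le_log h2 h1
  rw [Real.log_mul (Real.rpow_pos_of_pos hx _).ne' (Real.rpow_pos_of_pos hy _).ne',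
    Real.log_rpow hx, Real.log_rpow hy] at h3
  have h4 := Real.log_nonpos hx.le (hk1 x)
  have h5 := Real.log_nonpos hy.le (hk1 y)
  rw [negLog_of_pos (h2.trans_le h1), negLog_of_pos hx, negLog_of_pos hy,
    ← ENNReal.ofReal_mul ht'.le, ← ENNReal.ofReal_mul ht.1.le,
    ← ENNReal.ofReal_add (mul_nonneg ht'.le (neg_nonneg.2 h4))
      (mul_nonneg ht.1.le (neg_nonneg.2 h5))]
  exact ENNReal.ofReal_le_ofReal (by linarith)

theorem isLogConcaveFn_expNeg {I : E₁ → ℝ≥0∞}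
    (hI : ∀ x y : E₁, ∀ t ∈ Ioo (0 : ℝ) 1,
      I ((1 - t) • x + t • y) ≤ ENNReal.ofReal (1 - t) * I x + ENNReal.ofReal t * I y) :
    IsLogConcaveFn fun x => expNeg (I x) := by
  refine ⟨fun x => expNeg_nonneg _, fun x y t ht => ?_⟩
  rcases ht.1.eq_or_lt with rfl | ht0
  · simp
  rcases ht.2.eq_or_lt with rfl | ht1
  · simp
  have ht' : 0 < 1 - t := by linarith
  dsimp only
  by_cases hx : I x = ⊤
  · rw [hx, expNeg, if_pos rfl, Real.zero_rpow ht'.ne', zero_mul]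
    exact expNeg_nonneg _
  by_cases hy : I y = ⊤
  · rw [hy, expNeg, expNeg, if_pos (rfl : (⊤ : ℝ≥0∞) = ⊤), Real.zero_rpow ht0.ne', mul_zero]
    exact expNeg_nonneg _
  have hle := hI x y t ⟨ht0, ht1⟩
  have hfin : ENNReal.ofReal (1 - t) * I x + ENNReal.ofReal t * I y ≠ ⊤ := by finiteness
  rw [expNeg_of_ne_top hx, expNeg_of_ne_top hy, expNeg_of_ne_top (ne_top_of_le_ne_top hfin hle),
    ← Real.exp_mul, ← Real.exp_mul, ← Real.exp_add, Real.exp_le_exp]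
  have h2 := ENNReal.toReal_mono hfin hle
  rw [ENNReal.toReal_add (by finiteness) (by finiteness), ENNReal.toReal_mul, ENNReal.toReal_mul,
    ENNReal.toReal_ofReal ht'.le, ENNReal.toReal_ofReal ht0.le] at h2
  linarith

theorem IsLogConcaveFn.lintegral_negLog_le [MeasurableSpace E₂] {ν : Measure E₂}
    {k : E₁ × E₂ → ℝ} (hk : IsLogConcaveFn k) (hk1 : ∀ p, k p ≤ 1)
    (hm : ∀ x, Measurable fun z => k (x, z)) {x y : E₁} {t : ℝ} (ht : t ∈ Ioo (0 : ℝ) 1) :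
    ∫⁻ z, negLog (k ((1 - t) • x + t • y, z)) ∂ν ≤
      ENNReal.ofReal (1 - t) * ∫⁻ z, negLog (k (x, z)) ∂ν +
        ENNReal.ofReal t * ∫⁻ z, negLog (k (y, z)) ∂ν := by
  have hm' := fun x => measurable_negLog.comp (hm x)
  simp only [Function.comp_def] at hm'
  rw [← lintegral_const_mul _ (hm' x), ← lintegral_const_mul _ (hm' y),
    ← lintegral_add_left ((hm' x).const_mul _)]
  refine lintegral_mono fun z => ?_
  have h := hk.negLog_le hk1 (x := (x, z)) (y := (y, z)) ht
  rwa [Prod.smul_mk, Prod.smul_mk, Prod.mk_add_mk, ← add_smul, sub_add_cancel, one_smul] at h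

theorem IsLogConcaveFn.comp_prodMk_left {k : E₁ × E₂ → ℝ} (hk : IsLogConcaveFn k) (x : E₁) :
    IsLogConcaveFn fun z => k (x, z) := by
  refine ⟨fun z => hk.1 _, fun y z t ht => ?_⟩
  have h := hk.2 (x, y) (x, z) t ht
  rwa [Prod.smul_mk, Prod.smul_mk, Prod.mk_add_mk, ← add_smul, sub_add_cancel, one_smul] at h

end PartialMean

section Product

/-- Equality case of the Gibbs inequality. -/
theorem IsDensity.ae_eq_of_integral_log_nonneg {E : Type*} [MeasureSpace E] {f m : E → ℝ}
    (hf : IsDensity f) (hm : IsDensity m) (hpos : ∀ᵐ x ∂densityMeasure m, 0 < f x)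
    (hi : Integrable (fun x => Real.log (f x) - Real.log (m x)) (densityMeasure m))
    (h0 : 0 ≤ ∫ x, (Real.log (f x) - Real.log (m x)) ∂densityMeasure m) :
    f =ᵐ[volume] m := by
  have := hm.isProbabilityMeasure
  have hint : ∀ {g : E → ℝ}, IsDensity g → ∫ x, g x = 1 := fun {g} hg => by
    rw [integral_eq_lintegral_of_nonneg_ae (ae_of_all _ hg.1)
      hg.2.1.aestronglyMeasurable, hg.2.2, ENNReal.toReal_one]
  have hle : ∀ x, m x * (f x / m x) ≤ f x := fun x => by
    rcases (hm.1 x).eq_or_lt with h | h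
    · rw [← h, zero_mul]; exact hf.1 x
    · rw [mul_div_cancel₀ _ h.ne']
  have hui : Integrable (fun x => f x / m x) (densityMeasure m) := by
    rw [hm.integrable_densityMeasure_iff]
    refine hf.integrable.mono' (hm.2.1.mul (hf.2.1.div hm.2.1)).aestronglyMeasurable
      (ae_of_all _ fun x => ?_)
    rw [Real.norm_of_nonneg (mul_nonneg (hm.1 x) (div_nonneg (hf.1 x) (hm.1 x)))]
    exact hle x
  have hu1 : ∫ x, f x / m x ∂densityMeasure m ≤ 1 := by
    rw [hm.integral_densityMeasure, ← hint hf]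
    exact integral_mono (hm.integrable_densityMeasure_iff.1 hui) hf.integrable hle
  have hui1 := hui.sub (integrable_const (1 : ℝ))
  have hnn : 0 ≤ᵐ[densityMeasure m]
      fun x => f x / m x - 1 - (Real.log (f x) - Real.log (m x)) := by
    filter_upwards [hpos, hm.ae_pos] with x hx hmx
    have := Real.log_le_sub_one_of_pos (div_pos hx hmx)
    rw [Real.log_div hx.ne' hmx.ne'] at this
    simpa using this
  have hzero : ∫ x, (f x / m x - 1 - (Real.log (f x) - Real.log (m x))) ∂densityMeasure m = 0 := by
    refine le_antisymm ?_ (integral_nonneg_of_ae hnn)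
    have h1 : ∫ x, (f x / m x - 1 - (Real.log (f x) - Real.log (m x))) ∂densityMeasure m
        = ∫ x, (f x / m x - 1) ∂densityMeasure m
          - ∫ x, (Real.log (f x) - Real.log (m x)) ∂densityMeasure m := integral_sub hui1 hi
    rw [h1, integral_sub hui (integrable_const 1)]
    simp only [integral_const, probReal_univ, one_smul]
    linarith
  rw [integral_eq_zero_iff_of_nonneg_ae hnn (hui1.sub hi)] at hzero
  have heq : ∀ᵐ x ∂densityMeasure m, f x = m x := by
    filter_upwards [hpos, hm.ae_pos, hzero] with x hx hmx hzx
    by_contra hne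
    have := Real.log_lt_sub_one_of_pos (div_pos hx hmx) fun h => hne ((div_eq_one_iff_eq hmx.ne').1 h)
    rw [Real.log_div hx.ne' hmx.ne'] at this
    simp only [Pi.zero_apply] at hzx
    linarith
  rw [densityMeasure, ae_withDensity_iff hm.2.1.ennreal_ofReal] at heq
  have hge : 0 ≤ᵐ[volume] fun x => f x - m x := by
    filter_upwards [heq] with x hx
    rcases (hm.1 x).eq_or_lt with h | h
    · rw [← h, sub_zero]; exact hf.1 x
    · rw [hx (by simpa using h), sub_self]; exact le_rfl
  have hz : ∫ x, (f x - m x) = 0 := by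
    rw [integral_sub hf.integrable hm.integrable, hint hf, hint hm, sub_self]
  rw [integral_eq_zero_iff_of_nonneg_ae hge (hf.integrable.sub hm.integrable)] at hz
  filter_upwards [hz] with x hx
  exact sub_eq_zero.1 hx

theorem IsLCDensity.prod {E₁ E₂ : Type*} [NormedAddCommGroup E₁] [NormedSpace ℝ E₁]
    [MeasureSpace E₁] [NormedAddCommGroup E₂] [NormedSpace ℝ E₂] [MeasureSpace E₂]
    [SFinite (volume : Measure E₂)] {f₁ : E₁ → ℝ} {f₂ : E₂ → ℝ} (hf₁ : IsLCDensity f₁)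
    (hf₂ : IsLCDensity f₂) : IsLCDensity fun p : E₁ × E₂ => f₁ p.1 * f₂ p.2 := by
  have hlc₁ : IsLogConcaveFn fun p : E₁ × E₂ => f₁ p.1 :=
    ⟨fun p => hf₁.1.1 _, fun p q => hf₁.2.2.2 p.1 q.1⟩
  have hlc₂ : IsLogConcaveFn fun p : E₁ × E₂ => f₂ p.2 :=
    ⟨fun p => hf₂.1.1 _, fun p q => hf₂.2.2.2 p.2 q.2⟩
  refine ⟨⟨(hlc₁.mul hlc₂).1, ?_, ?_⟩, ?_, hlc₁.mul hlc₂⟩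
  · exact (hf₁.1.2.1.comp measurable_fst).mul (hf₂.1.2.1.comp measurable_snd)
  · simp only [ENNReal.ofReal_mul (hf₁.1.1 _)]
    rw [Measure.volume_eq_prod, lintegral_prod_mul hf₁.1.2.1.ennreal_ofReal.aemeasurable
      hf₂.1.2.1.ennreal_ofReal.aemeasurable, hf₁.1.2.2, hf₂.1.2.2, one_mul]
  · exact (hf₁.2.1.comp continuous_fst).mul_of_nonneg (hf₂.2.1.comp continuous_snd) hlc₁.1 hlc₂.1

theorem densityMeasure_prod {E₁ E₂ : Type*} [MeasureSpace E₁] [MeasureSpace E₂]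
    [SFinite (volume : Measure E₂)] {f₁ : E₁ → ℝ} {f₂ : E₂ → ℝ} (hf₁ : IsDensity f₁)
    (hf₂ : IsDensity f₂) :
    (densityMeasure f₁).prod (densityMeasure f₂)
      = densityMeasure fun p : E₁ × E₂ => f₁ p.1 * f₂ p.2 := by
  have := hf₂.isProbabilityMeasure
  simp only [densityMeasure, ENNReal.ofReal_mul (hf₁.1 _)] at this ⊢
  rw [prod_withDensity hf₁.2.1.ennreal_ofReal hf₂.2.1.ennreal_ofReal, Measure.volume_eq_prod]

variable {E₁ E₂ : Type*} [NormedAddCommGroup E₁] [NormedSpace ℝ E₁] [FiniteDimensional ℝ E₁]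
  [MeasureSpace E₁] [BorelSpace E₁] [(volume : Measure E₁).IsAddHaarMeasure]
  [NormedAddCommGroup E₂] [NormedSpace ℝ E₂] [FiniteDimensional ℝ E₂]
  [MeasureSpace E₂] [BorelSpace E₂] [(volume : Measure E₂).IsAddHaarMeasure]

/-- Integrated first-order condition for both marginals of a product measure. -/
theorem IsLCProj.integral_log_prod_le {P₁ : Measure E₁} {P₂ : Measure E₂} (h₁ : MemP P₁)
    (h₂ : MemP P₂) {f₁ : E₁ → ℝ} {f₂ : E₂ → ℝ} (hf₁ : IsLCProj P₁ f₁) (hf₂ : IsLCProj P₂ f₂)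
    {k : E₁ × E₂ → ℝ} (hk : IsLogConcaveFn k) (hku : UpperSemicontinuous k)
    (hk1 : ∀ p, k p ≤ 1) (hkpos : ∀ᵐ p ∂P₁.prod P₂, 0 < k p)
    (hki : Integrable (fun p => Real.log (k p)) (P₁.prod P₂)) :
    (∀ᵐ p ∂(densityMeasure f₁).prod (densityMeasure f₂), 0 < k p) ∧
      Integrable (fun p => Real.log (k p)) ((densityMeasure f₁).prod (densityMeasure f₂)) ∧
      ∫ p, Real.log (k p) ∂P₁.prod P₂ + ∫ x, Real.log (f₁ x) ∂densityMeasure f₁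
          + ∫ z, Real.log (f₂ z) ∂densityMeasure f₂ ≤
        ∫ x, Real.log (f₁ x) ∂P₁ + ∫ z, Real.log (f₂ z) ∂P₂
          + ∫ p, Real.log (k p) ∂(densityMeasure f₁).prod (densityMeasure f₂) := by
  have := h₁.1
  have := h₂.1
  have := hf₁.1.1.isProbabilityMeasure
  have := hf₂.1.1.isProbabilityMeasure
  have hf₁i := hf₁.integrable_log h₁
  have hf₂i := hf₂.integrable_log h₂
  set ν₁ := densityMeasure f₁
  set ν₂ := densityMeasure f₂
  have hkm : Measurable k := hku.measurable
  have hsecu : ∀ x, UpperSemicontinuous fun z => k (x, z) := fun x =>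
    hku.comp (Continuous.prodMk_right x)
  let I : E₁ → ℝ≥0∞ := fun x => ∫⁻ z, negLog (k (x, z)) ∂ν₂
  let G : E₁ → ℝ := fun x => expNeg (I x)
  have hIlsc : LowerSemicontinuous I :=
    lowerSemicontinuous_lintegral (fun x => measurable_negLog.comp (hsecu x).measurable)
      fun z => (hku.comp (Continuous.prodMk_left z)).negLog
  have hGu : UpperSemicontinuous G := UpperSemicontinuous.expNeg hIlsc
  have hGlc : IsLogConcaveFn G := isLogConcaveFn_expNeg fun x y t ht =>
    hk.lintegral_negLog_le hk1 (fun x => (hsecu x).measurable) ht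
  have hG1 : ∀ x, G x ≤ 1 := fun x => expNeg_le_one _
  set c := ∫ z, Real.log (f₂ z) ∂P₂ - ∫ z, Real.log (f₂ z) ∂ν₂ with hc
  have hsec : ∀ᵐ x ∂P₁, 0 < G x ∧ ∫ z, Real.log (k (x, z)) ∂P₂ - c ≤ Real.log (G x) := by
    filter_upwards [Measure.ae_ae_of_ae_prod hkpos, hki.prod_right_ae] with x hx1 hx2
    obtain ⟨hp, hi, hle⟩ := hf₂.integral_log_sub_le h₂ (hk.comp_prodMk_left x) (hsecu x)
      (fun z => hk1 (x, z)) hx1 hx2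
    have hki' : Integrable (fun z => Real.log (k (x, z))) ν₂ := by
      exact (hi.add hf₂i).congr (ae_of_all _ fun z => sub_add_cancel _ _)
    have hIx : I x = ENNReal.ofReal (-∫ z, Real.log (k (x, z)) ∂ν₂) :=
      lintegral_negLog_of_integrable (fun z => hk1 (x, z)) hp hki'
    have hnonpos : ∫ z, Real.log (k (x, z)) ∂ν₂ ≤ 0 :=
      integral_nonpos_of_ae (hp.mono fun z hz => Real.log_nonpos hz.le (hk1 _))
    have hGx : G x = Real.exp (∫ z, Real.log (k (x, z)) ∂ν₂) := by
      simp only [G]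
      rw [hIx, expNeg_of_ne_top ENNReal.ofReal_ne_top,
        ENNReal.toReal_ofReal (neg_nonneg.2 hnonpos), neg_neg]
    rw [hGx, Real.log_exp]
    refine ⟨Real.exp_pos _, ?_⟩
    rw [integral_sub hx2 hf₂.2.2.1, integral_sub hki' hf₂i] at hle
    linarith
  have hGm : Measurable fun x => Real.log (G x) := Real.measurable_log.comp hGu.measurable
  have hai : Integrable (fun x => ∫ z, Real.log (k (x, z)) ∂P₂ - c) P₁ :=
    hki.integral_prod_left.sub (integrable_const c)
  have hGi : Integrable (fun x => Real.log (G x)) P₁ := by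
    refine hai.mono hGm.aestronglyMeasurable (hsec.mono fun x hx => ?_)
    have h0 := Real.log_nonpos hx.1.le (hG1 x)
    rw [Real.norm_of_nonpos h0, Real.norm_of_nonpos (hx.2.trans h0)]
    linarith [hx.2]
  have hint := integral_mono_ae hai hGi (hsec.mono fun x hx => hx.2)
  rw [integral_sub hki.integral_prod_left (integrable_const c), ← integral_prod _ hki] at hint
  simp only [integral_const, probReal_univ, one_smul] at hint
  obtain ⟨hp, hi, hle⟩ := hf₁.integral_log_sub_le h₁ hGlc hGu hG1 (hsec.mono fun x hx => hx.1) hGi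
  have hGi' : Integrable (fun x => Real.log (G x)) ν₁ :=
    (hi.add hf₁i).congr (ae_of_all _ fun x => sub_add_cancel _ _)
  rw [integral_sub hGi hf₁.2.2.1, integral_sub hGi' hf₁i] at hle
  have hprod : ∫⁻ p, negLog (k p) ∂ν₁.prod ν₂ = ENNReal.ofReal (-∫ x, Real.log (G x) ∂ν₁) := by
    rw [lintegral_prod (fun p => negLog (k p)) (measurable_negLog.comp hkm).aemeasurable,
      ← lintegral_negLog_of_integrable hG1 hp hGi']
    exact lintegral_congr fun x => (negLog_expNeg _).symm
  obtain ⟨hkp, hkn, hkint⟩ := integral_log_eq_of_negLog (ν := ν₁.prod ν₂) hkm hk1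
    (by rw [hprod]; exact ENNReal.ofReal_ne_top)
  refine ⟨hkp, hkn, ?_⟩
  rw [hprod, ENNReal.toReal_ofReal (neg_nonneg.2 (integral_nonpos_of_ae
    (hp.mono fun x hx => Real.log_nonpos hx.le (hG1 x)))), neg_neg] at hkint
  rw [hkint]
  linarith

theorem IsLCProj.eq_mul_of_prod {P₁ : Measure E₁} {P₂ : Measure E₂} (h₁ : MemP P₁)
    (h₂ : MemP P₂) {f : E₁ × E₂ → ℝ} (hf : IsLCProj (P₁.prod P₂) f) {f₁ : E₁ → ℝ}
    (hf₁ : IsLCProj P₁ f₁) {f₂ : E₂ → ℝ} (hf₂ : IsLCProj P₂ f₂) (p : E₁ × E₂) :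
    f p = f₁ p.1 * f₂ p.2 := by
  have := h₁.1
  have := h₂.1
  have := hf₁.1.1.isProbabilityMeasure
  have := hf₂.1.1.isProbabilityMeasure
  have hm := hf₁.1.prod hf₂.1
  have : (volume : Measure (E₁ × E₂)).IsAddHaarMeasure := by
    rw [Measure.volume_eq_prod]; infer_instance
  obtain ⟨M, hM0, hM⟩ := hf.1.exists_bound
  have hlogM : ∀ p, 0 < f p → Real.log (f p / M) = Real.log (f p) - Real.log M := fun p hp =>
    Real.log_div hp.ne' hM0.ne'
  have hkP : (fun p => Real.log (f p) - Real.log M) =ᵐ[P₁.prod P₂]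
      fun p => Real.log (f p / M) := hf.2.1.mono fun p hp => (hlogM p hp).symm
  obtain ⟨hpos, hi, hle⟩ := IsLCProj.integral_log_prod_le h₁ h₂ hf₁ hf₂
    (hf.1.2.2.div_const hM0) (hf.1.2.1.div_const_of_pos hM0) (fun p => (div_le_one hM0).2 (hM p))
    (hf.2.1.mono fun p hp => div_pos hp hM0)
    ((hf.2.2.1.sub (integrable_const (Real.log M))).congr hkP)
  set ν₁ := densityMeasure f₁
  set ν₂ := densityMeasure f₂
  replace hpos : ∀ᵐ p ∂ν₁.prod ν₂, 0 < f p :=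
    hpos.mono fun p hp => (div_pos_iff_of_pos_right hM0).1 hp
  have hkν : (fun p => Real.log (f p / M)) =ᵐ[ν₁.prod ν₂]
      fun p => Real.log (f p) - Real.log M := hpos.mono fun p hp => hlogM p hp
  replace hi : Integrable (fun p => Real.log (f p)) (ν₁.prod ν₂) := by
    exact ((hi.congr hkν).add (integrable_const (Real.log M))).congr
      (ae_of_all _ fun p => sub_add_cancel _ _)
  rw [← integral_congr_ae hkP, integral_congr_ae hkν, integral_sub hf.2.2.1 (integrable_const _),
    integral_sub hi (integrable_const _)] at hle
  simp only [integral_const, probReal_univ, one_smul] at hle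
  have hlogm : ∀ {Q₁ : Measure E₁} {Q₂ : Measure E₂} [IsProbabilityMeasure Q₁]
      [IsProbabilityMeasure Q₂], (∀ᵐ x ∂Q₁, 0 < f₁ x) → (∀ᵐ z ∂Q₂, 0 < f₂ z) →
      Integrable (fun x => Real.log (f₁ x)) Q₁ → Integrable (fun z => Real.log (f₂ z)) Q₂ →
      (∀ᵐ p ∂Q₁.prod Q₂, 0 < f₁ p.1 * f₂ p.2) ∧
      Integrable (fun p => Real.log (f₁ p.1 * f₂ p.2)) (Q₁.prod Q₂) ∧
      ∫ p, Real.log (f₁ p.1 * f₂ p.2) ∂Q₁.prod Q₂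
        = ∫ x, Real.log (f₁ x) ∂Q₁ + ∫ z, Real.log (f₂ z) ∂Q₂ := by
    intro Q₁ Q₂ _ _ hp₁ hp₂ hi₁ hi₂
    have hp₁' := (Measure.quasiMeasurePreserving_fst (μ := Q₁) (ν := Q₂)).ae hp₁
    have hp₂' := (Measure.quasiMeasurePreserving_snd (μ := Q₁) (ν := Q₂)).ae hp₂
    have heq : (fun p : E₁ × E₂ => Real.log (f₁ p.1) + Real.log (f₂ p.2)) =ᵐ[Q₁.prod Q₂]
        fun p => Real.log (f₁ p.1 * f₂ p.2) := by
      filter_upwards [hp₁', hp₂'] with p h1 h2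
      exact (Real.log_mul h1.ne' h2.ne').symm
    refine ⟨by filter_upwards [hp₁', hp₂'] with p h1 h2 using mul_pos h1 h2,
      ((hi₁.comp_fst Q₂).add (hi₂.comp_snd Q₁)).congr heq, ?_⟩
    rw [← integral_congr_ae heq, integral_add (hi₁.comp_fst Q₂) (hi₂.comp_snd Q₁),
      integral_fun_fst (fun x => Real.log (f₁ x)), integral_fun_snd (fun z => Real.log (f₂ z))]
    simp
  obtain ⟨hmp, hmi, hmint⟩ := hlogm hf₁.2.1 hf₂.2.1 hf₁.2.2.1 hf₂.2.2.1
  obtain ⟨-, hmi', hmint'⟩ := hlogm hf₁.1.1.ae_pos hf₂.1.1.ae_pos (hf₁.integrable_log h₁)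
    (hf₂.integrable_log h₂)
  have hmax := hf.2.2.2 _ hm hmp hmi
  have hsub := integral_sub hi hmi'
  have hsubi := hi.sub hmi'
  have h0 : 0 ≤ ∫ p, (Real.log (f p) - Real.log (f₁ p.1 * f₂ p.2)) ∂ν₁.prod ν₂ := by
    rw [hsub, hmint']
    linarith
  rw [densityMeasure_prod hf₁.1.1 hf₂.1.1] at hpos h0 hsubi
  have hae := hf.1.1.ae_eq_of_integral_log_nonneg hm.1 hpos hsubi h0
  exact le_antisymm (hf.1.le_of_ae_eq hm.2.1 hm.1.1 hae p)
    (hm.le_of_ae_eq hf.1.2.1 hf.1.1.1 hae.symm p)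

end Product

/-- Log-concave projection preserves product structure (independence of components). -/
theorem statement10 (d₁ d₂ : ℕ)
    (P₁ : Measure (Rd d₁)) (P₂ : Measure (Rd d₂))
    (h₁ : MemP P₁) (h₂ : MemP P₂) (hP : MemP (P₁.prod P₂))
    (f : Rd d₁ × Rd d₂ → ℝ) (hf : IsLCProj (P₁.prod P₂) f)
    (f₁ : Rd d₁ → ℝ) (hf₁ : IsLCProj P₁ f₁)
    (f₂ : Rd d₂ → ℝ) (hf₂ : IsLCProj P₂ f₂) :
    ∀ (x₁ : Rd d₁) (x₂ : Rd d₂), f (x₁, x₂) = f₁ x₁ * f₂ x₂ :=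
  fun x₁ x₂ => hf.eq_mul_of_prod h₁ h₂ hf₁ hf₂ (x₁, x₂)
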